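/- arXiv:2509.11870 — 5 statements merged into one kernel-verified Lean document; each statement's English description precedes it below -/
import Mathlib

section
/- Let p and q be distinct primes with N = p·q and gcd(N, (p−1)·(q−1)) = 1, and let λ = lcm(p−1, q−1). Let m be a natural number with m < N and let r be an integer coprime to N. Define the ciphertext c = (N+1)^m · r^N mod N². Then c^λ mod N² is congruent to 1 modulo N, and writing c^λ mod N² = 1 + N·u for some natural number u (so L(c^λ mod N²) = u), we have u · λ⁻¹ ≡ m (mod N), where λ⁻¹ is the inverse of λ modulo N. In other words, Paillier decryption correctly recovers m. -/
theorem paillier_aux_pow (N k : ℤ) (n : ℕ) :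
    (1 + N * k) ^ n ≡ 1 + n * (N * k) [ZMOD N ^ 2] := by
  induction n with
  | zero => simp
  | succ n ih =>
    rw [pow_succ (1 + N * k) n]
    refine (ih.mul_right _).trans ?_
    refine (Int.modEq_iff_dvd.2 ⟨-(n * k ^ 2), ?_⟩)
    push_cast
    ring

theorem paillier_aux_fermat (p : ℕ) (hp : p.Prime) (r : ℤ) (hr : IsCoprime r (p : ℤ)) (l : ℕ)
    (hl : p - 1 ∣ l) : (p : ℤ) ∣ r ^ l - 1 := by
  obtain ⟨t, rfl⟩ := hl
  have h := (Int.ModEq.pow_card_sub_one_eq_one hp hr).pow t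
  rw [one_pow, ← pow_mul] at h
  exact h.symm.dvd

/-- Correctness of Paillier decryption: for distinct primes `p, q` with `N = p·q` and
`gcd(N, (p−1)(q−1)) = 1`, `λ = lcm(p−1, q−1)`, message `m < N` and randomness `r`
coprime to `N`, the ciphertext `c = (N+1)^m · r^N mod N²` satisfies
`c^λ mod N² ≡ 1 (mod N)`, and writing `c^λ mod N² = 1 + N·u` (so `L(c^λ mod N²) = u`),
we have `u · λ⁻¹ ≡ m (mod N)`. -/
theorem paillier_decryption_correct (p q : ℕ) (hp : p.Prime) (hq : q.Prime) (hpq : p ≠ q)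
    (N lam : ℕ) (hN : N = p * q) (hcop : Nat.Coprime N ((p - 1) * (q - 1)))
    (hlam : lam = Nat.lcm (p - 1) (q - 1))
    (m : ℕ) (hm : m < N) (r : ℤ) (hr : IsCoprime r (N : ℤ))
    (c : ℤ) (hc : c = ((N : ℤ) + 1) ^ m * r ^ N % ((N : ℤ) ^ 2))
    (laminv : ℤ) (hlaminv : (lam : ℤ) * laminv ≡ 1 [ZMOD (N : ℤ)]) :
    (c ^ lam % ((N : ℤ) ^ 2)) ≡ 1 [ZMOD (N : ℤ)] ∧
      ∀ u : ℕ, c ^ lam % ((N : ℤ) ^ 2) = 1 + (N : ℤ) * u →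
        (u : ℤ) * laminv ≡ (m : ℤ) [ZMOD (N : ℤ)] := by
  have hN0 : (N : ℤ) ≠ 0 := by
    have : 0 < N := by omega
    exact_mod_cast this.ne'
  have hrN : (N : ℤ) ∣ r ^ lam - 1 := by
    have hNc : (N : ℤ) = (p : ℤ) * q := by rw [hN]; push_cast; rfl
    rw [hNc] at hr ⊢
    have hc : IsCoprime (p : ℤ) (q : ℤ) :=
      Nat.isCoprime_iff_coprime.2 ((Nat.coprime_primes hp hq).2 hpq)
    refine hc.mul_dvd ?_ ?_
    · exact paillier_aux_fermat p hp r hr.of_mul_right_left lam (hlam ▸ Nat.dvd_lcm_left _ _)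
    · exact paillier_aux_fermat q hq r hr.of_mul_right_right lam (hlam ▸ Nat.dvd_lcm_right _ _)
  obtain ⟨k, hk⟩ := hrN
  have hk' : r ^ lam = 1 + N * k := by linarith
  have h1 : (r ^ N) ^ lam ≡ 1 [ZMOD (N : ℤ) ^ 2] := by
    rw [← pow_mul, mul_comm, pow_mul, hk']
    refine (paillier_aux_pow N k N).trans (Int.modEq_iff_dvd.2 ⟨-k, by ring⟩)
  have h2 : (((N : ℤ) + 1) ^ m) ^ lam ≡ 1 + N * (m * lam) [ZMOD (N : ℤ) ^ 2] := by
    have h := paillier_aux_pow N 1 (m * lam)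
    rw [← pow_mul]
    convert h using 1
    · ring
    · push_cast; ring
  have h3 : c ^ lam % (N : ℤ) ^ 2 ≡ 1 + N * (m * lam) [ZMOD (N : ℤ) ^ 2] := by
    refine (Int.mod_modEq _ _).trans ?_
    rw [hc]
    refine ((Int.mod_modEq _ _).pow lam).trans ?_
    rw [mul_pow]
    simpa using h2.mul h1
  constructor
  · refine (h3.of_dvd (Dvd.intro_left (N : ℤ) (by ring))).trans ?_
    exact Int.modEq_iff_dvd.2 ⟨-(m * lam), by ring⟩
  · intro u hu
    rw [hu] at h3
    obtain ⟨t, ht⟩ := h3.dvd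
    have h4 : (m * lam : ℤ) - u = N * t := by
      apply mul_left_cancel₀ hN0
      linear_combination ht
    have h5 : (u : ℤ) ≡ m * lam [ZMOD (N : ℤ)] := Int.modEq_iff_dvd.2 ⟨t, h4⟩
    have h6 := hlaminv.mul_left (m : ℤ)
    rw [mul_one, ← mul_assoc] at h6
    exact (h5.mul_right laminv).trans h6
end

section
/- Let p and q be distinct primes with N = p·q and gcd(N, (p−1)·(q−1)) = 1, and let λ = lcm(p−1, q−1). Let m₁, m₂ < N be natural numbers and r₁, r₂ integers coprime to N, with ciphertexts c₁ = (N+1)^{m₁} · r₁^N mod N² and c₂ = (N+1)^{m₂} · r₂^N mod N². Then Paillier decryption of the product c₁ · c₂ mod N² yields (m₁ + m₂) mod N; i.e. L((c₁·c₂)^λ mod N²) · λ⁻¹ ≡ m₁ + m₂ (mod N). -/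
/-- First-order binomial expansion modulo `N ^ 2`. -/
lemma one_add_mul_pow_modEq (N k : ℤ) (n : ℕ) :
    (1 + N * k) ^ n ≡ 1 + N * (k * n) [ZMOD N ^ 2] := by
  induction n with
  | zero => simp [Int.ModEq]
  | succ n ih =>
    rw [pow_succ (1 + N * k)]
    refine (ih.mul_right _).trans ?_
    refine (Int.modEq_iff_dvd.mpr ⟨-(k * k * n), ?_⟩)
    push_cast
    ring

/-- Fermat, for an exponent divisible by `p - 1`. -/
lemma pow_modEq_one_of_dvd (p l : ℕ) (hp : p.Prime) (hl : p - 1 ∣ l) (r : ℤ)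
    (hr : IsCoprime r (p : ℤ)) : (p : ℤ) ∣ r ^ l - 1 := by
  obtain ⟨k, rfl⟩ := hl
  have h := (Int.ModEq.pow_card_sub_one_eq_one hp hr).pow k
  rw [one_pow, ← pow_mul] at h
  exact h.symm.dvd

/-- Additive homomorphic property of Paillier (the `Add` operation): decrypting the
product `c₁ · c₂ mod N²` of two ciphertexts yields `m₁ + m₂ (mod N)`. -/
theorem paillier_add_homomorphic (p q : ℕ) (hp : p.Prime) (hq : q.Prime) (hpq : p ≠ q)
    (N lam : ℕ) (hN : N = p * q) (hcop : Nat.Coprime N ((p - 1) * (q - 1)))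
    (hlam : lam = Nat.lcm (p - 1) (q - 1))
    (m₁ m₂ : ℕ) (hm₁ : m₁ < N) (hm₂ : m₂ < N)
    (r₁ r₂ : ℤ) (hr₁ : IsCoprime r₁ (N : ℤ)) (hr₂ : IsCoprime r₂ (N : ℤ))
    (c₁ c₂ : ℤ)
    (hc₁ : c₁ = ((N : ℤ) + 1) ^ m₁ * r₁ ^ N % ((N : ℤ) ^ 2))
    (hc₂ : c₂ = ((N : ℤ) + 1) ^ m₂ * r₂ ^ N % ((N : ℤ) ^ 2))
    (laminv : ℤ) (hlaminv : (lam : ℤ) * laminv ≡ 1 [ZMOD (N : ℤ)]) :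
    ∀ u : ℕ, (c₁ * c₂ % ((N : ℤ) ^ 2)) ^ lam % ((N : ℤ) ^ 2) = 1 + (N : ℤ) * u →
      (u : ℤ) * laminv ≡ (m₁ : ℤ) + (m₂ : ℤ) [ZMOD (N : ℤ)] := by
  intro u hu
  have hN0 : (N : ℤ) ≠ 0 := by
    rw [hN]
    exact_mod_cast Nat.mul_ne_zero hp.ne_zero hq.ne_zero
  have hr : IsCoprime (r₁ * r₂) (N : ℤ) := hr₁.mul_left hr₂
  have hNc : (N : ℤ) = p * q := by rw [hN]; push_cast; rfl
  have hdvd : (N : ℤ) ∣ (r₁ * r₂) ^ lam - 1 := by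
    rw [hNc] at hr ⊢
    refine IsCoprime.mul_dvd ?_ ?_ ?_
    · exact Nat.isCoprime_iff_coprime.mpr ((Nat.coprime_primes hp hq).mpr hpq)
    · exact pow_modEq_one_of_dvd p lam hp (hlam ▸ Nat.dvd_lcm_left _ _) _ hr.of_mul_right_left
    · exact pow_modEq_one_of_dvd q lam hq (hlam ▸ Nat.dvd_lcm_right _ _) _ hr.of_mul_right_right
  obtain ⟨k, hk⟩ := hdvd
  have hR : ((r₁ * r₂) ^ lam) ^ N ≡ 1 [ZMOD (N : ℤ) ^ 2] := by
    have e : (r₁ * r₂) ^ lam = 1 + (N : ℤ) * k := by linarith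
    rw [e]
    refine (one_add_mul_pow_modEq N k N).trans (Int.modEq_iff_dvd.mpr ⟨-k, by ring⟩)
  have hG : ((N : ℤ) + 1) ^ ((m₁ + m₂) * lam) ≡
      1 + N * (((m₁ : ℤ) + m₂) * lam) [ZMOD (N : ℤ) ^ 2] := by
    have h := one_add_mul_pow_modEq N 1 ((m₁ + m₂) * lam)
    rw [mul_one, add_comm (1 : ℤ) N, one_mul] at h
    push_cast at h
    exact h
  have h1 : c₁ ≡ ((N : ℤ) + 1) ^ m₁ * r₁ ^ N [ZMOD (N : ℤ) ^ 2] := by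
    rw [hc₁]; exact Int.mod_modEq _ _
  have h2 : c₂ ≡ ((N : ℤ) + 1) ^ m₂ * r₂ ^ N [ZMOD (N : ℤ) ^ 2] := by
    rw [hc₂]; exact Int.mod_modEq _ _
  have h3 : 1 + (N : ℤ) * u ≡ 1 + N * (((m₁ : ℤ) + m₂) * lam) [ZMOD (N : ℤ) ^ 2] := by
    rw [← hu]
    refine (Int.mod_modEq _ _).trans ?_
    refine (((Int.mod_modEq _ _).trans (h1.mul h2)).pow lam).trans ?_
    have e : (((N : ℤ) + 1) ^ m₁ * r₁ ^ N * (((N : ℤ) + 1) ^ m₂ * r₂ ^ N)) ^ lam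
        = ((N : ℤ) + 1) ^ ((m₁ + m₂) * lam) * ((r₁ * r₂) ^ lam) ^ N := by
      rw [pow_mul, ← pow_mul (r₁ * r₂), mul_comm lam N, pow_mul (r₁ * r₂), ← mul_pow,
        pow_add, mul_pow r₁]
      congr 1
      ring
    rw [e]
    simpa using hG.mul hR
  have h4 : (u : ℤ) ≡ ((m₁ : ℤ) + m₂) * lam [ZMOD (N : ℤ)] := by
    obtain ⟨t, ht⟩ := h3.dvd
    refine Int.modEq_iff_dvd.mpr ⟨t, mul_left_cancel₀ hN0 ?_⟩
    linear_combination ht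
  have h5 := (h4.mul_right laminv).trans
    (by simpa [mul_assoc] using hlaminv.mul_left ((m₁ : ℤ) + m₂))
  exact h5
end

section
/- Let p and q be distinct primes with N = p·q and gcd(N, (p−1)·(q−1)) = 1, and let λ = lcm(p−1, q−1). Let d be a natural number, and for each j < d let m_j < N be a natural number, r_j an integer coprime to N, c_j = (N+1)^{m_j} · r_j^N mod N² its Paillier ciphertext, and a_j a natural number. Then Paillier decryption of the combined ciphertext ∏_{j<d} c_j^{a_j} mod N² yields (∑_{j<d} a_j · m_j) mod N. -/
theorem aux_fermat (p lam : ℕ) (hp : p.Prime) (h : p - 1 ∣ lam) (x : ℤ)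
    (hx : IsCoprime x (p : ℤ)) : (p : ℤ) ∣ x ^ lam - 1 := by
  obtain ⟨k, rfl⟩ := h
  have h1 := (Int.ModEq.pow_card_sub_one_eq_one hp hx).pow k
  rw [one_pow, ← pow_mul] at h1
  exact h1.symm.dvd

theorem aux_binom (N : ℤ) (s : ℕ) : (N + 1) ^ s ≡ 1 + N * s [ZMOD N ^ 2] := by
  induction s with
  | zero => simp
  | succ k ih =>
    rw [pow_succ (N + 1)]
    refine (ih.mul_right _).trans ?_
    refine Int.modEq_iff_dvd.2 ⟨-k, ?_⟩
    push_cast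
    ring

/-- Correctness of the SecNorm ciphertext computation: decrypting the combined
ciphertext `∏_{j<d} c_j^{a_j} mod N²` yields the plaintext dot product
`∑_{j<d} a_j · m_j (mod N)`. -/
theorem paillier_linear_combination_correct (p q : ℕ) (hp : p.Prime) (hq : q.Prime)
    (hpq : p ≠ q) (N lam : ℕ) (hN : N = p * q)
    (hcop : Nat.Coprime N ((p - 1) * (q - 1)))
    (hlam : lam = Nat.lcm (p - 1) (q - 1))
    (d : ℕ) (m : Fin d → ℕ) (hm : ∀ j, m j < N)
    (r : Fin d → ℤ) (hr : ∀ j, IsCoprime (r j) (N : ℤ))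
    (c : Fin d → ℤ)
    (hc : ∀ j, c j = ((N : ℤ) + 1) ^ (m j) * (r j) ^ N % ((N : ℤ) ^ 2))
    (a : Fin d → ℕ)
    (laminv : ℤ) (hlaminv : (lam : ℤ) * laminv ≡ 1 [ZMOD (N : ℤ)]) :
    ∀ u : ℕ,
      ((∏ j : Fin d, (c j) ^ (a j)) % ((N : ℤ) ^ 2)) ^ lam % ((N : ℤ) ^ 2)
          = 1 + (N : ℤ) * u →
        (u : ℤ) * laminv ≡ (∑ j : Fin d, (a j : ℤ) * (m j : ℤ)) [ZMOD (N : ℤ)] := by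
  intro u hu
  have hN0 : (N : ℤ) ≠ 0 := by
    subst hN
    exact_mod_cast Nat.mul_ne_zero hp.ne_zero hq.ne_zero
  have hrl : ∀ j, (r j ^ N) ^ lam ≡ 1 [ZMOD (N : ℤ) ^ 2] := by
    intro j
    have hj := hr j
    have hd : (N : ℤ) ∣ r j ^ lam - 1 := by
      rw [hN, Nat.cast_mul] at hj ⊢
      refine IsCoprime.mul_dvd ?_ ?_ ?_
      · exact Nat.isCoprime_iff_coprime.2 ((Nat.coprime_primes hp hq).2 hpq)
      · exact aux_fermat p lam hp (hlam ▸ Nat.dvd_lcm_left _ _) _ hj.of_mul_right_left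
      · exact aux_fermat q lam hq (hlam ▸ Nat.dvd_lcm_right _ _) _ hj.of_mul_right_right
    have h2 := dvd_sub_pow_of_dvd_sub hd 1
    rw [pow_one, one_pow, ← pow_mul, mul_comm lam N, pow_mul] at h2
    exact (Int.modEq_iff_dvd.2 h2).symm
  have hcj : ∀ j, (c j ^ a j) ^ lam ≡ ((N : ℤ) + 1) ^ (lam * (a j * m j)) [ZMOD (N : ℤ) ^ 2] := by
    intro j
    have h1 : c j ≡ ((N : ℤ) + 1) ^ (m j) * (r j) ^ N [ZMOD (N : ℤ) ^ 2] := by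
      rw [hc j]
      exact Int.mod_modEq _ _
    have h2 := (h1.pow (a j)).pow lam
    refine h2.trans ?_
    have h3 := ((hrl j).pow (a j)).mul_left (((N : ℤ) + 1) ^ (lam * (a j * m j)))
    rw [one_pow, mul_one] at h3
    refine Eq.trans ?_ h3
    congr 1
    ring
  have hprod : (∏ j : Fin d, (c j) ^ (a j)) ^ lam
      ≡ ((N : ℤ) + 1) ^ (lam * ∑ j, a j * m j) [ZMOD (N : ℤ) ^ 2] := by
    rw [← Finset.prod_pow, Finset.mul_sum, ← Finset.prod_pow_eq_pow_sum]
    exact Int.ModEq.prod fun j _ => hcj j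
  have h1 : 1 + (N : ℤ) * u ≡ 1 + (N : ℤ) * ((lam * ∑ j, a j * m j : ℕ) : ℤ) [ZMOD (N : ℤ) ^ 2] := by
    rw [← hu]
    exact (Int.mod_modEq _ _).trans
      ((((Int.mod_modEq _ _).pow lam).trans hprod).trans (aux_binom _ _))
  have h2 : (u : ℤ) ≡ ((lam * ∑ j, a j * m j : ℕ) : ℤ) [ZMOD (N : ℤ)] := by
    have h3 := (Int.ModEq.add_left_cancel' 1 h1).dvd
    rw [← mul_sub, pow_two] at h3
    exact Int.modEq_iff_dvd.2 ((mul_dvd_mul_iff_left hN0).1 h3)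
  have h4 := h2.mul_right laminv
  have h5 := hlaminv.mul_right (∑ j : Fin d, (a j : ℤ) * (m j : ℤ))
  rw [one_mul] at h5
  refine h4.trans (Eq.trans ?_ h5)
  push_cast
  congr 1
  ring
end

section
/- Let d, k be natural numbers with k ≥ 1, and let x ∈ ℝ^d. Let R be a random k × d matrix whose entries R i j are independent Gaussian random variables with mean 0 and variance 1/k. Then the expected squared Euclidean norm of the projected vector equals the squared norm of x: E[ ∑_{i<k} ( ∑_{j<d} R i j · x j )² ] = ‖x‖². -/
open MeasureTheory ProbabilityTheory

theorem jl_projection_unbiased (d k : ℕ) (hk : 1 ≤ k) (x : EuclideanSpace ℝ (Fin d)) :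
    ∫ R : Fin k × Fin d → ℝ,
        (∑ i : Fin k, (∑ j : Fin d, R (i, j) * x j) ^ 2)
        ∂(Measure.pi fun _ : Fin k × Fin d => gaussianReal 0 ((k : NNReal))⁻¹)
      = ‖x‖ ^ 2 := by
  set v : NNReal := ((k : NNReal))⁻¹ with hv
  set P := Measure.pi fun _ : Fin k × Fin d => gaussianReal 0 v with hP
  have hmp : ∀ p : Fin k × Fin d,
      MeasurePreserving (fun R : Fin k × Fin d → ℝ => R p) P (gaussianReal 0 v) :=
    fun p => measurePreserving_eval (fun _ : Fin k × Fin d => gaussianReal 0 v) p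
  have hL : ∀ p : Fin k × Fin d, MemLp (fun R : Fin k × Fin d → ℝ => R p) 2 P := fun p =>
    (memLp_id_gaussianReal' 2 (by simp)).comp_measurePreserving (hmp p)
  have hmean : ∀ p : Fin k × Fin d, ∫ R, R p ∂P = 0 := by
    intro p
    have := integral_eval (μ := fun _ : Fin k × Fin d => gaussianReal 0 v) (i := p)
    rw [hP, this, integral_id_gaussianReal]
  have hvar : ∀ p : Fin k × Fin d, Var[fun R : Fin k × Fin d → ℝ => R p; P] = v := by
    intro p
    have h := variance_map (X := id) (Y := fun R : Fin k × Fin d → ℝ => R p) (μ := P)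
      (by fun_prop) (measurable_pi_apply p).aemeasurable
    rw [(hmp p).map_eq, variance_id_gaussianReal] at h
    exact h.symm
  have hind : iIndepFun (fun (p : Fin k × Fin d) (R : Fin k × Fin d → ℝ) => R p) P :=
    iIndepFun_pi (X := fun _ => id) (fun _ => aemeasurable_id)
  have hLx : ∀ i j, MemLp (fun R : Fin k × Fin d → ℝ => R (i, j) * x j) 2 P := fun i j =>
    (hL (i, j)).mul_const (x j)
  have hLs : ∀ i, MemLp (fun R : Fin k × Fin d → ℝ => ∑ j, R (i, j) * x j) 2 P := fun i =>
    memLp_finsetSum _ fun j _ => hLx i j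
  have hrow : ∀ i, ∫ R, (∑ j, R (i, j) * x j) ^ 2 ∂P = (k : ℝ)⁻¹ * ‖x‖ ^ 2 := by
    intro i
    have h0 : ∫ R, (∑ j, R (i, j) * x j) ∂P = 0 := by
      rw [integral_finsetSum _ fun j _ => (hLx i j).integrable (by norm_num)]
      simp [integral_mul_const, hmean]
    rw [← variance_of_integral_eq_zero (hLs i).aemeasurable h0]
    have := IndepFun.variance_sum (μ := P) (s := Finset.univ)
      (X := fun j (R : Fin k × Fin d → ℝ) => R (i, j) * x j) (fun j _ => hLx i j)
      (fun a _ b _ hab => (hind.indepFun (i := (i, a)) (j := (i, b)) (by simpa using hab)).comp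
        (φ := fun y => y * x a) (ψ := fun y => y * x b) (by fun_prop) (by fun_prop))
    have e : (∑ j, fun R : Fin k × Fin d → ℝ => R (i, j) * x j)
        = fun R => ∑ j, R (i, j) * x j := by ext R; simp
    rw [e] at this
    rw [this, EuclideanSpace.real_norm_sq_eq, Finset.mul_sum]
    refine Finset.sum_congr rfl fun j _ => ?_
    rw [variance_mul_const, hvar]
    simp [hv]
  rw [integral_finsetSum _ fun i _ => (hLs i).integrable_sq]
  have : (k : ℝ) ≠ 0 := by positivity
  simp [hrow]
  field_simp
end

section
/- Let d, k be natural numbers with k ≥ 1, let x ∈ ℝ^d be nonzero, and let 0 < ε < 1. Let R be a random k × d matrix whose entries R i j are independent Gaussian random variables with mean 0 and variance 1/k. Then the probability that (1−ε)·‖x‖² ≤ ‖R x‖² ≤ (1+ε)·‖x‖² is at least 1 − 2·exp(−k·(ε² − ε³)/4), where ‖R x‖² = ∑_{i<k} ( ∑_{j<d} R i j · x j )². -/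
open MeasureTheory ProbabilityTheory

lemma jl_pdf_mul (v : NNReal) (hv : v ≠ 0) (t y : ℝ) :
    gaussianPDFReal 0 v y * Real.exp (t * y ^ 2) =
      (√(2 * Real.pi * v))⁻¹ * Real.exp (-((1 - 2 * t * v) / (2 * v)) * y ^ 2) := by
  have hv' : (v : ℝ) ≠ 0 := by exact_mod_cast hv
  rw [gaussianPDFReal_def, mul_assoc, ← Real.exp_add]
  congr 2
  field_simp
  ring

lemma jl_gauss_integrable (v : NNReal) (hv : v ≠ 0) (t : ℝ) (ht : 2 * t * v < 1) :
    Integrable (fun y => Real.exp (t * y ^ 2)) (gaussianReal 0 v) := by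
  have hv' : (0 : ℝ) < v := by exact_mod_cast pos_iff_ne_zero.mpr hv
  rw [gaussianReal_of_var_ne_zero _ hv,
    integrable_withDensity_iff_integrable_smul' (measurable_gaussianPDF _ _)
      (ae_of_all _ fun _ ↦ gaussianPDF_lt_top)]
  simp only [toReal_gaussianPDF, smul_eq_mul, jl_pdf_mul v hv t]
  exact (integrable_exp_neg_mul_sq (div_pos (by linarith) (by positivity))).const_mul _

lemma jl_gauss_integral (v : NNReal) (hv : v ≠ 0) (t : ℝ) (ht : 2 * t * v < 1) :
    ∫ y, Real.exp (t * y ^ 2) ∂(gaussianReal 0 v) = (√(1 - 2 * t * v))⁻¹ := by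
  have hv' : (0 : ℝ) < v := by exact_mod_cast pos_iff_ne_zero.mpr hv
  have h1 : 0 < 1 - 2 * t * v := by linarith
  rw [integral_gaussianReal_eq_integral_smul hv]
  simp only [smul_eq_mul, jl_pdf_mul v hv t]
  rw [integral_const_mul, integral_gaussian, ← Real.sqrt_inv, ← Real.sqrt_inv,
    ← Real.sqrt_mul (by positivity)]
  congr 1
  have := Real.pi_pos
  field_simp

lemma jl_log_upper (x : ℝ) (hx : 0 ≤ x) : Real.log (1 + x) ≤ x - x ^ 2 / 2 + x ^ 3 / 2 := by
  have hm : MonotoneOn (fun x : ℝ => x - x ^ 2 / 2 + x ^ 3 / 2 - Real.log (1 + x)) (Set.Ici 0) := by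
    have hd : ∀ y : ℝ, 0 ≤ y → HasDerivAt
        (fun x : ℝ => x - x ^ 2 / 2 + x ^ 3 / 2 - Real.log (1 + x))
        (1 - y + 3 * y ^ 2 / 2 - 1 / (1 + y)) y := by
      intro y hy
      have h1 : HasDerivAt (fun x : ℝ => 1 + x) 1 y := (hasDerivAt_id y).const_add 1
      have h2 := h1.log (by positivity)
      refine HasDerivAt.congr_deriv ((((hasDerivAt_id y).sub
        ((hasDerivAt_pow 2 y).div_const 2)).add ((hasDerivAt_pow 3 y).div_const 2)).sub h2) ?_
      norm_num
    refine monotoneOn_of_deriv_nonneg (convex_Ici 0)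
      (fun y hy => (hd y hy).continuousAt.continuousWithinAt) ?_ ?_
    · intro y hy
      rw [interior_Ici] at hy
      exact (hd y (le_of_lt hy)).differentiableAt.differentiableWithinAt
    · intro y hy
      rw [interior_Ici] at hy
      have hy : 0 < y := hy
      rw [(hd y hy.le).deriv]
      have : 1 - y + 3 * y ^ 2 / 2 - 1 / (1 + y) = (y ^ 2 / 2 + 3 * y ^ 3 / 2) / (1 + y) := by
        field_simp
        ring
      rw [this]
      positivity
  have := hm (Set.mem_Ici.mpr le_rfl) (Set.mem_Ici.mpr hx) hx
  simp at this
  linarith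

lemma jl_log_lower (x : ℝ) (hx : 0 ≤ x) (hx1 : x < 1) : Real.log (1 - x) ≤ -x - x ^ 2 / 2 := by
  have h := Real.hasSum_pow_div_log_of_abs_lt_one (x := x) (by rwa [abs_of_nonneg hx])
  have := sum_le_hasSum (Finset.range 2) (fun i _ => by positivity) h
  simp [Finset.sum_range_succ] at this
  norm_num at this
  linarith

lemma jl_sqrt_exp (a : ℝ) (ha : 0 < a) : √a = Real.exp (Real.log a / 2) := by
  rw [← Real.log_sqrt ha.le, Real.exp_log (Real.sqrt_pos.mpr ha)]

section
variable (d k : ℕ) (v : NNReal)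

lemma jl_rows_indep :
    iIndepFun (fun (i : Fin k) (R : Fin k × Fin d → ℝ) (j : Fin d) => R (i, j))
      (Measure.pi fun _ : Fin k × Fin d => gaussianReal 0 v) := by
  have hc := Measure.infinitePi_map_curry
    (fun (_ : Fin k) (_ : Fin d) => gaussianReal 0 v)
  simp only [Measure.infinitePi_eq_pi] at hc
  have hc' : (Measure.pi fun _ : Fin k × Fin d => gaussianReal 0 v).map
      (fun R i j => R (i, j)) =
      Measure.pi fun _ : Fin k => Measure.pi fun _ : Fin d => gaussianReal 0 v := hc
  rw [iIndepFun_iff_map_fun_eq_pi_map (fun i => Measurable.aemeasurable (by fun_prop)), hc']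
  congr
  ext1 i
  have : (fun (R : Fin k × Fin d → ℝ) (j : Fin d) => R (i, j)) =
      (fun f : Fin k → Fin d → ℝ => f i) ∘ (fun R i j => R (i, j)) := rfl
  rw [this, ← Measure.map_map (by fun_prop) (by fun_prop), hc']
  exact ((measurePreserving_eval (fun _ : Fin k => Measure.pi fun _ : Fin d => gaussianReal 0 v)
    i).map_eq).symm

lemma jl_row_law (x : Fin d → ℝ) (i : Fin k) (w : NNReal)
    (hw : (w : ℝ) = v * ∑ j, x j ^ 2) :
    (Measure.pi fun _ : Fin k × Fin d => gaussianReal 0 v).map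
      (fun R => ∑ j : Fin d, R (i, j) * x j) = gaussianReal 0 w := by
  set P := Measure.pi fun _ : Fin k × Fin d => gaussianReal 0 v with hP
  have hind : iIndepFun (fun (p : Fin k × Fin d) (R : Fin k × Fin d → ℝ) => R p * x p.2) P :=
    iIndepFun_pi (μ := fun _ : Fin k × Fin d => gaussianReal 0 v)
      (X := fun p y => y * x p.2) (fun p => by fun_prop)
  have hind2 : iIndepFun (fun (j : Fin d) (R : Fin k × Fin d → ℝ) => R (i, j) * x j) P :=
    hind.precomp (g := fun j => (i, j)) (fun a b h => by simpa using h)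
  apply Measure.ext_of_charFun
  ext t
  have hs := iIndepFun.charFun_map_fun_sum_eq_prod
    (fun j => Measurable.aemeasurable (by fun_prop)) hind2
  rw [hs]
  have hl : ∀ j, P.map (fun R => R (i, j) * x j) = gaussianReal (x j * 0)
      (NNReal.mk (x j ^ 2) (sq_nonneg _) * v) := by
    intro j
    have : (fun R : Fin k × Fin d → ℝ => R (i, j) * x j) =
      (fun y => y * x j) ∘ (fun R => R (i, j)) := rfl
    rw [this, ← Measure.map_map (by fun_prop) (by fun_prop), hP,
      (measurePreserving_eval (fun _ : Fin k × Fin d => gaussianReal 0 v) (i, j)).map_eq,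
      gaussianReal_map_mul_const]
  simp only [Finset.prod_apply, hl, charFun_gaussianReal, ← Complex.exp_sum]
  congr 1
  have hw' : (w : ℂ) = v * ∑ j, (x j : ℂ) ^ 2 := by exact_mod_cast congrArg Complex.ofReal hw
  have hc : ∀ j, (((NNReal.mk (x j ^ 2) (sq_nonneg _) * v : NNReal) : ℝ) : ℂ) = (x j : ℂ) ^ 2 * v := by
    intro j
    rw [NNReal.coe_mul, Complex.ofReal_mul]
    simp
  simp only [hc, hw', Finset.mul_sum, Finset.sum_mul, Finset.sum_div, mul_zero,
    Complex.ofReal_zero, zero_mul, zero_sub, Finset.sum_neg_distrib]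
  congr 1
  exact Finset.sum_congr rfl (fun j _ => by ring)

lemma jl_mgf (x : Fin d → ℝ) (w : NNReal) (hw0 : w ≠ 0)
    (hw : (w : ℝ) = v * ∑ j, x j ^ 2) (t : ℝ) (ht : 2 * t * w < 1) :
    Integrable (fun R : Fin k × Fin d → ℝ =>
      Real.exp (t * ∑ i : Fin k, (∑ j : Fin d, R (i, j) * x j) ^ 2))
      (Measure.pi fun _ : Fin k × Fin d => gaussianReal 0 v) ∧
    mgf (fun R : Fin k × Fin d → ℝ => ∑ i : Fin k, (∑ j : Fin d, R (i, j) * x j) ^ 2)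
      (Measure.pi fun _ : Fin k × Fin d => gaussianReal 0 v) t = (√(1 - 2 * t * w))⁻¹ ^ k := by
  set P := Measure.pi fun _ : Fin k × Fin d => gaussianReal 0 v with hP
  have hind := (jl_rows_indep d k v).comp (fun _ r => (∑ j, r j * x j) ^ 2)
    (fun _ => by fun_prop)
  have he : (fun R : Fin k × Fin d → ℝ => ∑ i : Fin k, (∑ j : Fin d, R (i, j) * x j) ^ 2) =
    ∑ i : Fin k, (fun r : Fin d → ℝ => (∑ j, r j * x j) ^ 2) ∘
      (fun (R : Fin k × Fin d → ℝ) (j : Fin d) => R (i, j)) := by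
    ext R; simp
  have hm : ∀ i : Fin k, Measurable ((fun r : Fin d → ℝ => (∑ j, r j * x j) ^ 2) ∘
      (fun (R : Fin k × Fin d → ℝ) (j : Fin d) => R (i, j))) := fun i => by fun_prop
  have hint : ∀ i : Fin k, Integrable (fun R : Fin k × Fin d → ℝ =>
      Real.exp (t * (∑ j, R (i, j) * x j) ^ 2)) P := by
    intro i
    have h := jl_gauss_integrable w hw0 t ht
    rw [← jl_row_law d k v x i w hw] at h
    exact h.comp_measurable (by fun_prop)
  have hval : ∀ i : Fin k, ∫ R : Fin k × Fin d → ℝ,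
      Real.exp (t * (∑ j, R (i, j) * x j) ^ 2) ∂P = (√(1 - 2 * t * w))⁻¹ := by
    intro i
    rw [← jl_gauss_integral w hw0 t ht, ← jl_row_law d k v x i w hw,
      integral_map (Measurable.aemeasurable (by fun_prop))
        (Measurable.aestronglyMeasurable (by fun_prop))]
  constructor
  · have := hind.integrable_exp_mul_sum hm (s := Finset.univ) (t := t) (fun i _ => hint i)
    rw [← he] at this
    exact this
  · rw [he, hind.mgf_sum hm]
    have : ∀ i : Fin k, mgf ((fun r : Fin d → ℝ => (∑ j, r j * x j) ^ 2) ∘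
      (fun (R : Fin k × Fin d → ℝ) (j : Fin d) => R (i, j))) P t = (√(1 - 2 * t * w))⁻¹ :=
      fun i => hval i
    rw [Finset.prod_congr rfl (fun i _ => this i)]
    simp
end

/-- Distributional Johnson–Lindenstrauss lemma with Gaussian random projections: for a
random `k × d` matrix `R` with i.i.d. Gaussian entries of mean `0` and variance `1/k`,
the squared norm of `R x` lies in `[(1−ε)‖x‖², (1+ε)‖x‖²]` with probability at least
`1 − 2·exp(−k(ε² − ε³)/4)`. -/
theorem jl_distributional_lemma (d k : ℕ) (hk : 1 ≤ k)
    (x : EuclideanSpace ℝ (Fin d)) (hx : x ≠ 0)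
    (ε : ℝ) (hε0 : 0 < ε) (hε1 : ε < 1) :
    ENNReal.ofReal (1 - 2 * Real.exp (-(k : ℝ) * (ε ^ 2 - ε ^ 3) / 4)) ≤
      (Measure.pi fun _ : Fin k × Fin d => gaussianReal 0 ((k : NNReal))⁻¹)
        {R : Fin k × Fin d → ℝ |
          (1 - ε) * ‖x‖ ^ 2 ≤ ∑ i : Fin k, (∑ j : Fin d, R (i, j) * x j) ^ 2 ∧
            ∑ i : Fin k, (∑ j : Fin d, R (i, j) * x j) ^ 2 ≤ (1 + ε) * ‖x‖ ^ 2} := by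
  set P := Measure.pi fun _ : Fin k × Fin d => gaussianReal 0 ((k : NNReal))⁻¹ with hP
  have hk0 : (0 : ℝ) < k := by exact_mod_cast hk
  have hn : 0 < ‖x‖ := norm_pos_iff.mpr hx
  set w : NNReal := (k : NNReal)⁻¹ * ‖x‖₊ ^ 2 with hwdef
  have hwr : (w : ℝ) = (k : ℝ)⁻¹ * ‖x‖ ^ 2 := by simp [hwdef]
  have hwpos : (0 : ℝ) < w := by rw [hwr]; positivity
  have hw0 : w ≠ 0 := by
    intro h
    rw [h] at hwpos
    simp at hwpos
  have hw : (w : ℝ) = ((k : NNReal)⁻¹ : NNReal) * ∑ j, x j ^ 2 := by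
    rw [hwr, EuclideanSpace.real_norm_sq_eq]; simp
  have hkw : ‖x‖ ^ 2 = k * w := by rw [hwr]; field_simp
  set S : (Fin k × Fin d → ℝ) → ℝ := fun R => ∑ i : Fin k, (∑ j : Fin d, R (i, j) * x j) ^ 2
    with hS
  have hSm : Measurable S := by fun_prop
  set B := Real.exp (-(k : ℝ) * (ε ^ 2 - ε ^ 3) / 4) with hB
  have hup : P.real {R | (1 + ε) * ‖x‖ ^ 2 ≤ S R} ≤ B := by
    have hsub : 1 - 2 * (ε / (2 * (1 + ε) * w)) * w = (1 + ε)⁻¹ := by field_simp; ring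
    obtain ⟨h1, h2⟩ := jl_mgf d k (k : NNReal)⁻¹ x w hw0 hw (ε / (2 * (1 + ε) * w))
      (by have : (0 : ℝ) < (1 + ε)⁻¹ := by positivity
          linarith)
    refine (measure_ge_le_exp_mul_mgf _ (by positivity) h1).trans ?_
    rw [h2, hsub, Real.sqrt_inv, inv_inv, jl_sqrt_exp _ (by positivity), ← Real.exp_nat_mul,
      ← Real.exp_add, hB, Real.exp_le_exp, hkw]
    have := mul_le_mul_of_nonneg_left (jl_log_upper ε hε0.le) hk0.le
    have h3 : -(ε / (2 * (1 + ε) * w)) * ((1 + ε) * (k * w)) = - (k * ε / 2) := by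
      field_simp
    rw [h3]
    nlinarith
  have hlo : P.real {R | S R ≤ (1 - ε) * ‖x‖ ^ 2} ≤ B := by
    have hε : 0 < 1 - ε := by linarith
    have hsub : 1 - 2 * (-(ε / (2 * (1 - ε) * w))) * w = (1 - ε)⁻¹ := by field_simp; ring
    obtain ⟨h1, h2⟩ := jl_mgf d k (k : NNReal)⁻¹ x w hw0 hw (-(ε / (2 * (1 - ε) * w)))
      (by have : (0 : ℝ) < (1 - ε)⁻¹ := by positivity
          linarith)
    refine (measure_le_le_exp_mul_mgf _ (neg_nonpos.mpr (by positivity)) h1).trans ?_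
    rw [h2, hsub, Real.sqrt_inv, inv_inv, jl_sqrt_exp _ (by positivity), ← Real.exp_nat_mul,
      ← Real.exp_add, hB, Real.exp_le_exp, hkw]
    have := mul_le_mul_of_nonneg_left (jl_log_lower ε hε0.le hε1) hk0.le
    have h3 : -(-(ε / (2 * (1 - ε) * w))) * ((1 - ε) * (k * w)) = k * ε / 2 := by
      field_simp
    have h4 : 0 ≤ k * ε ^ 3 := by positivity
    rw [h3]
    nlinarith
  have hmeas : MeasurableSet {R | (1 - ε) * ‖x‖ ^ 2 ≤ S R ∧ S R ≤ (1 + ε) * ‖x‖ ^ 2} :=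
    (measurableSet_le measurable_const hSm).inter (measurableSet_le hSm measurable_const)
  have hcompl : P.real {R | (1 - ε) * ‖x‖ ^ 2 ≤ S R ∧ S R ≤ (1 + ε) * ‖x‖ ^ 2}ᶜ ≤ 2 * B := by
    refine (measureReal_mono (μ := P) (s₂ := {R | S R ≤ (1 - ε) * ‖x‖ ^ 2} ∪
      {R | (1 + ε) * ‖x‖ ^ 2 ≤ S R}) ?_ (measure_ne_top _ _)).trans ((measureReal_union_le _ _).trans (by linarith))
    intro R hR
    simp only [Set.mem_compl_iff, Set.mem_ofPred_eq, not_and_or, not_le] at hR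
    exact hR.imp le_of_lt le_of_lt
  rw [probReal_compl_eq_one_sub hmeas] at hcompl
  change _ ≤ P {R | (1 - ε) * ‖x‖ ^ 2 ≤ S R ∧ S R ≤ (1 + ε) * ‖x‖ ^ 2}
  rw [← ofReal_measureReal]
  exact ENNReal.ofReal_le_ofReal (by linarith)
end
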